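/- arXiv:math/0305058 — 4 statements merged into one kernel-verified Lean document; each statement's English description precedes it below -/
import Mathlib

section
/- Let B be a finite set with |B| = 2k and let α, β, γ be three fixed-point-free involutions of B, regarded as the three colour classes of a proper 3-edge-colouring of a cubic graph on vertex set B. If this coloured cubic graph is bipartite, i.e. there exists ε : B → ZMod 2 with ε(α x) = ε(x) + 1, ε(β x) = ε(x) + 1 and ε(γ x) = ε(x) + 1 for all x ∈ B, then the total number of faces of the faithful embedding, namely (number of orbits of ⟨α, β⟩) + (number of orbits of ⟨β, γ⟩) + (number of orbits of ⟨γ, α⟩), is congruent to k modulo 2. -/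
open Equiv

/-- The cycles of a permutation, fixed points included, are its nontrivial cycle factors together
with its fixed points. -/
theorem Equiv.Perm.natCard_quotient_sameCycle {X : Type*} [Fintype X] [DecidableEq X]
    (f : Perm X) :
    Nat.card (Quotient (Perm.SameCycle.setoid f)) =
      f.cycleFactorsFinset.card + Fintype.card (Function.fixedPoints f) := by
  let F : X → f.cycleFactorsFinset ⊕ Function.fixedPoints f := fun x =>
    if h : f x = x then Sum.inr ⟨x, h⟩
    else Sum.inl ⟨f.cycleOf x,
      Perm.cycleOf_mem_cycleFactorsFinset_iff.2 (Perm.mem_support.2 h)⟩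
  have hF : ∀ x y, f.SameCycle x y → F x = F y := by
    intro x y h
    by_cases hx : f x = x
    · have hy : x = y := h.eq_of_left hx
      rw [hy]
    · have hy : ¬ f y = y := fun hy => hx (h.apply_eq_self_iff.2 hy)
      simp [F, hx, hy, h.cycleOf_eq]
  have hbij : Function.Bijective
      (Quotient.lift F hF : Quotient (Perm.SameCycle.setoid f) → _) := by
    constructor
    · rintro ⟨x⟩ ⟨y⟩ h
      refine Quotient.sound (?_ : f.SameCycle x y)
      change F x = F y at h
      by_cases hx : f x = x <;> by_cases hy : f y = y <;> simp [F, hx, hy] at h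
      · obtain rfl : x = y := congrArg Subtype.val h
        exact Perm.SameCycle.refl _ _
      · exact (Perm.sameCycle_iff_cycleOf_eq_of_mem_support
          (Perm.mem_support.2 hx) (Perm.mem_support.2 hy)).2 h
    · rintro (⟨c, hc⟩ | ⟨x, hx⟩)
      · obtain ⟨x, hx⟩ := (Perm.mem_cycleFactorsFinset_iff.1 hc).1.nonempty_support
        refine ⟨Quotient.mk _ x, ?_⟩
        have hfx : ¬ f x = x :=
          Perm.mem_support.1 (Perm.mem_cycleFactorsFinset_support_le hc hx)
        simp [F, hfx, Perm.cycle_is_cycleOf hx hc]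
      · refine ⟨Quotient.mk _ x, ?_⟩
        have hfx : f x = x := hx
        simp [F, hfx]
  rw [Nat.card_congr (Equiv.ofBijective _ hbij), Nat.card_eq_fintype_card, Fintype.card_sum,
    Fintype.card_coe]

/-- The sign of a permutation in terms of its number of cycles, fixed points included. -/
theorem Equiv.Perm.sign_eq_neg_one_pow_natCard_quotient_sameCycle {X : Type*} [Fintype X]
    [DecidableEq X] (f : Perm X) :
    Perm.sign f =
      (-1) ^ (Fintype.card X + Nat.card (Quotient (Perm.SameCycle.setoid f))) := by
  have hle : f.support.card ≤ Fintype.card X := Finset.card_le_univ _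
  rw [Perm.natCard_quotient_sameCycle, Perm.sign_of_cycleType, Perm.card_fixedPoints,
    Perm.sum_cycleType, Perm.cycleType_def, Multiset.card_map, Finset.card_val]
  obtain ⟨n, hn⟩ := Nat.exists_eq_add_of_le hle
  have hexp : f.support.card + n + (f.cycleFactorsFinset.card + n) =
      f.support.card + f.cycleFactorsFinset.card + (n + n) := by omega
  rw [hn, Nat.add_sub_cancel_left, hexp, pow_add _ _ (n + n), (Even.add_self n).neg_one_pow,
    mul_one]

/-- If two involutions both exchange `p` with its complement, then the orbits of the group they
generate correspond to the cycles of their product on `p`. -/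
theorem natCard_orbitRel_closure_pair_eq_natCard_sameCycle {B : Type*} (α β : Perm B)
    (hα : ∀ x, α (α x) = x) (hβ : ∀ x, β (β x) = x) (p : B → Prop)
    (hpα : ∀ x, p (α x) ↔ ¬ p x) (hpβ : ∀ x, p (β x) ↔ ¬ p x)
    (hp : ∀ x, p ((α * β) x) ↔ p x) :
    Nat.card (MulAction.orbitRel.Quotient
        (Subgroup.closure {α, β} : Subgroup (Perm B)) B) =
      Nat.card (Quotient (Perm.SameCycle.setoid ((α * β).subtypePerm hp))) := by
  classical
  set g := (α * β).subtypePerm hp with hg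
  set H : Subgroup (Perm B) := Subgroup.closure {α, β} with hH
  let r : B → {x // p x} := fun x => if h : p x then ⟨x, h⟩ else ⟨α x, (hpα x).2 h⟩
  have hr : ∀ x : {x // p x}, r x = x := fun x => by simp [r, x.2]
  have hαH : α ∈ H := Subgroup.subset_closure (by simp)
  have hβH : β ∈ H := Subgroup.subset_closure (by simp)
  have hrα : ∀ x, g.SameCycle (r (α x)) (r x) := by
    intro x
    by_cases h : p x <;> simp [r, h, hpα, hα, Perm.SameCycle.refl]
  have hrβ : ∀ x, g.SameCycle (r (β x)) (r x) := by
    intro x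
    by_cases h : p x
    · have : r (β x) = g (r x) := by ext; simp [r, h, hpβ, hg]
      rw [this]
      exact Perm.sameCycle_apply_left.2 (Perm.SameCycle.refl _ _)
    · have : r x = g (r (β x)) := by ext; simp [r, h, hpβ, hg, hβ]
      rw [this]
      exact Perm.sameCycle_apply_right.2 (Perm.SameCycle.refl _ _)
  have hrH : ∀ h ∈ H, ∀ x, g.SameCycle (r (h x)) (r x) := by
    intro h hh
    induction hh using Subgroup.closure_induction with
    | mem a ha =>
      rcases ha with rfl | rfl
      · exact hrα
      · exact hrβ
    | one => exact fun x => Perm.SameCycle.refl _ _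
    | mul a b _ _ iha ihb => exact fun x => (iha (b x)).trans (ihb x)
    | inv a _ iha => exact fun x => by simpa using (iha (a⁻¹ x)).symm
  let F : B → Quotient (Perm.SameCycle.setoid g) := fun x => Quotient.mk _ (r x)
  have hF : ∀ x y, MulAction.orbitRel H B x y → F x = F y := by
    rintro _ y ⟨⟨h, hh⟩, rfl⟩
    exact Quotient.sound (hrH h hh y)
  refine Nat.card_congr (Equiv.ofBijective
    (Quotient.lift F hF : MulAction.orbitRel.Quotient H B → _) ⟨?_, ?_⟩)
  · have hmem : ∀ x, MulAction.orbitRel H B (r x) x := by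
      intro x
      by_cases h : p x
      · simp only [r, h, dite_true]
        exact (MulAction.orbitRel H B).refl x
      · simp only [r, h, dite_false]
        exact ⟨⟨α, hαH⟩, rfl⟩
    rintro ⟨x⟩ ⟨y⟩ h
    obtain ⟨i, hi⟩ : g.SameCycle (r x) (r y) := Quotient.exact h
    have hxy : MulAction.orbitRel H B (r y) (r x) := by
      refine ⟨⟨(α * β) ^ i, H.zpow_mem (H.mul_mem hαH hβH) i⟩, ?_⟩
      rw [← hi, hg, Perm.subtypePerm_zpow]
      rfl
    exact Quotient.sound ((MulAction.orbitRel H B).trans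
      ((MulAction.orbitRel H B).symm (hmem x))
      ((MulAction.orbitRel H B).trans ((MulAction.orbitRel H B).symm hxy) (hmem y)))
  · rintro ⟨x⟩
    exact ⟨Quotient.mk _ (x : B), congrArg (Quotient.mk _) (hr x)⟩

/-- if a cubic graph on `2 * k` vertices, properly 3-edge-coloured
by three fixed-point-free involutions `α`, `β`, `γ`, is bipartite, then the
total number of bicoloured polygons (faces of the faithful embedding) is
congruent to `k` modulo 2. -/
theorem faces_parity_of_bipartite {B : Type} [Fintype B] (k : ℕ)
    (α β γ : Equiv.Perm B)
    (hα : ∀ x, α (α x) = x) (hα' : ∀ x, α x ≠ x)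
    (hβ : ∀ x, β (β x) = x) (hβ' : ∀ x, β x ≠ x)
    (hγ : ∀ x, γ (γ x) = x) (hγ' : ∀ x, γ x ≠ x)
    (hcard : Fintype.card B = 2 * k)
    (hbip : ∃ ε : B → ZMod 2, ∀ x,
      ε (α x) = ε x + 1 ∧ ε (β x) = ε x + 1 ∧ ε (γ x) = ε x + 1) :
    (Nat.card (MulAction.orbitRel.Quotient
        (Subgroup.closure {α, β} : Subgroup (Equiv.Perm B)) B) +
     Nat.card (MulAction.orbitRel.Quotient
        (Subgroup.closure {β, γ} : Subgroup (Equiv.Perm B)) B) +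
     Nat.card (MulAction.orbitRel.Quotient
        (Subgroup.closure {γ, α} : Subgroup (Equiv.Perm B)) B)) % 2 = k % 2 := by
  classical
  obtain ⟨ε, hε⟩ := hbip
  have two : ∀ a : ZMod 2, a + 1 = 0 ↔ ¬ a = 0 := by decide
  have hpα : ∀ x, ε (α x) = 0 ↔ ¬ ε x = 0 := fun x => by rw [(hε x).1, two]
  have hpβ : ∀ x, ε (β x) = 0 ↔ ¬ ε x = 0 := fun x => by rw [(hε x).2.1, two]
  have hpγ : ∀ x, ε (γ x) = 0 ↔ ¬ ε x = 0 := fun x => by rw [(hε x).2.2, two]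
  have hαβ : ∀ x, ε ((α * β) x) = 0 ↔ ε x = 0 := fun x => by simp [hpα, hpβ]
  have hβγ : ∀ x, ε ((β * γ) x) = 0 ↔ ε x = 0 := fun x => by simp [hpβ, hpγ]
  have hγα : ∀ x, ε ((γ * α) x) = 0 ↔ ε x = 0 := fun x => by simp [hpγ, hpα]
  have hhalf : Fintype.card {x // ε x = 0} = k := by
    have h₁ : Fintype.card {x // ε x = 0} = Fintype.card {x // ¬ ε x = 0} :=
      Fintype.card_congr (α.subtypeEquiv fun x => by simp [hpα])
    have h₂ := Fintype.card_subtype_compl (fun x => ε x = 0)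
    have h₃ := Fintype.card_subtype_le (fun x => ε x = 0)
    omega
  have hprod : (α * β).subtypePerm (p := (ε · = 0)) hαβ * (β * γ).subtypePerm (p := (ε · = 0)) hβγ *
      (γ * α).subtypePerm (p := (ε · = 0)) hγα = 1 := by
    ext x
    change α (β (β (γ (γ (α x))))) = x
    rw [hγ, hβ, hα]
  have hsign := congrArg Perm.sign hprod
  rw [Perm.sign_mul, Perm.sign_mul, Perm.sign_one,
    Perm.sign_eq_neg_one_pow_natCard_quotient_sameCycle,
    Perm.sign_eq_neg_one_pow_natCard_quotient_sameCycle,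
    Perm.sign_eq_neg_one_pow_natCard_quotient_sameCycle, hhalf, ← pow_add, ← pow_add,
    neg_one_pow_eq_one_iff_even (by decide), Nat.even_iff] at hsign
  rw [natCard_orbitRel_closure_pair_eq_natCard_sameCycle α β hα hβ (ε · = 0) hpα hpβ hαβ,
    natCard_orbitRel_closure_pair_eq_natCard_sameCycle β γ hβ hγ (ε · = 0) hpβ hpγ hβγ,
    natCard_orbitRel_closure_pair_eq_natCard_sameCycle γ α hγ hα (ε · = 0) hpγ hpα hγα]
  omega
end

section
/- Let n ≥ 3 and let c : ZMod n → Fin 3 be a proper colouring of the vertices of a polygon with n vertices using at most three colours, i.e. c(i + 1) ≠ c(i) for all i ∈ ZMod n. Then the number of vertices whose two neighbours receive the same colour, i.e. the cardinality of {i ∈ ZMod n : c(i − 1) = c(i + 1)}, is even. -/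
/-- Going from `a` to `b` and then from `b` to `d` in `Fin 3`, by steps of `1` or `-1`, one
returns to the start exactly when the two steps have opposite signs. -/
theorem Fin.three_step_sign_mul {a b d : Fin 3} (hab : b ≠ a) (hbd : d ≠ b) :
    (if a = d then -1 else 1 : ℤˣ) =
      (if b = a + 1 then 1 else -1) * (if d = b + 1 then 1 else -1) := by
  revert a b d
  decide

/-- in a proper colouring of the vertices of a polygon with
`n ≥ 3` vertices using at most three colours, the number of vertices whose two
neighbours receive the same colour is even. -/
theorem even_card_same_coloured_neighbours (n : ℕ) (hn : 3 ≤ n)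
    (c : ZMod n → Fin 3) (hc : ∀ i : ZMod n, c (i + 1) ≠ c i) :
    Even (Nat.card {i : ZMod n // c (i - 1) = c (i + 1)}) := by
  have : NeZero n := ⟨by omega⟩
  let s : ZMod n → ℤˣ := fun i => if c (i + 1) = c i + 1 then 1 else -1
  have sign_mul (i : ZMod n) :
      (if c (i - 1) = c (i + 1) then -1 else 1 : ℤˣ) = s (i - 1) * s i := by
    have hi := hc (i - 1)
    rw [sub_add_cancel] at hi
    simpa only [s, sub_add_cancel] using Fin.three_step_sign_mul hi (hc i)
  have prod_shift : ∏ i, s (i - 1) = ∏ i, s i :=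
    Equiv.prod_comp (Equiv.subRight (1 : ZMod n)) s
  have prod_eq_one : ∏ i, (if c (i - 1) = c (i + 1) then -1 else 1 : ℤˣ) = 1 := by
    simp only [sign_mul, Finset.prod_mul_distrib, prod_shift, Int.units_mul_self]
  rw [Finset.prod_ite, Finset.prod_const, Finset.prod_const_one, mul_one] at prod_eq_one
  rw [Nat.card_eq_fintype_card, Fintype.card_subtype]
  exact (neg_one_pow_eq_one_iff_even (by decide)).mp prod_eq_one
end

section
/- Let α, β, γ be fixed-point-free involutions of a finite set B such that for every x ∈ B the three elements α x, β x, γ x are pairwise distinct, and let G be the simple cubic graph on B in which x is adjacent exactly to α x, β x and γ x (a properly 3-edge-coloured cubic graph, the three colours a, b, c being the matchings given by α, β, γ). For an orbit O of the subgroup ⟨α, β⟩, let the edge set of the corresponding ab-polygon be the set of edges {x, α x} and {x, β x} with x ∈ O, and define bc- and ca-polygons analogously. Let W be the symmetric difference (mod 2 sum) of the edge sets of an arbitrary finite family of such bicoloured polygons. Then every cycle of G all of whose edges lie in W has even length. -/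
theorem SimpleGraph.Walk.IsCycle.even_length_of_alternating {V : Type*} {G : SimpleGraph V}
    {u : V} {p : G.Walk u u} (hp : p.IsCycle) (F : Sym2 V → Prop)
    (hF : ∀ x y z, s(x, y) ∈ p.edges → s(y, z) ∈ p.edges → x ≠ z → (F s(x, y) ↔ ¬ F s(y, z))) :
    Even p.length := by
  have h3 := hp.three_le_length
  have hmem : ∀ i, i < p.length → s(p.getVert i, p.getVert (i + 1)) ∈ p.edges := fun i hi =>
    p.mk_mem_edges_iff_exists.2 ⟨i, hi, rfl⟩
  have hne : ∀ i, i + 2 ≤ p.length → p.getVert i ≠ p.getVert (i + 2) := by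
    intro i hi h
    rcases Nat.eq_zero_or_pos i with rfl | hi0
    · have := hp.getVert_injOn' (x₁ := 0) (x₂ := 2) (by simp) (by simp; omega) h
      omega
    · have := hp.getVert_injOn (x₁ := i) (x₂ := i + 2) (by simp; omega) (by simp; omega) h
      omega
  have hpar : ∀ i, i < p.length →
      (F s(p.getVert i, p.getVert (i + 1)) ↔ (Even i ↔ F s(p.getVert 0, p.getVert 1))) := by
    intro i
    induction i with
    | zero => simp
    | succ i ih =>
      intro hi
      have h1 := hF _ _ _ (hmem i (by omega)) (hmem (i + 1) hi) (hne i (by omega))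
      have h2 := ih (by omega)
      have h4 : Even (i + 1) ↔ ¬ Even i := Nat.even_add_one
      tauto
  obtain ⟨n, hn⟩ : ∃ n, p.length = n + 1 := ⟨p.length - 1, by omega⟩
  have hlast : p.getVert (n + 1) = p.getVert 0 := by
    rw [← hn, p.getVert_length, p.getVert_zero]
  have hwrap : p.getVert n ≠ p.getVert 1 := by
    intro h
    have := hp.getVert_injOn (x₁ := n) (x₂ := 1) (by simp; omega) (by simp; omega) h
    omega
  have h1 := hmem n (by omega)
  have h2 := hpar n (by omega)
  rw [hlast] at h1 h2
  have h5 := hF _ _ _ h1 (hmem 0 (by omega)) hwrap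
  have h4 : Even (n + 1) ↔ ¬ Even n := Nat.even_add_one
  rw [hn]
  simp only [zero_add] at h5
  tauto

theorem mk_orbitRel_apply_of_mem {B : Type*} (H : Subgroup (Equiv.Perm B)) {σ : Equiv.Perm B}
    (hσ : σ ∈ H) (x : B) :
    Quotient.mk (MulAction.orbitRel H B) (σ x) = Quotient.mk (MulAction.orbitRel H B) x :=
  Quotient.sound ⟨⟨σ, hσ⟩, rfl⟩

theorem apply_eq_of_mk_apply_eq {B : Type*} {σ τ : Equiv.Perm B} (hτ : ∀ x, τ (τ x) = x) {x y : B}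
    (h : s(x, σ x) = s(y, τ y)) : σ x = τ x ∧ (y = x ∨ y = σ x) := by
  rcases Sym2.eq_iff.1 h with ⟨rfl, h⟩ | ⟨h, rfl⟩
  · exact ⟨h, Or.inl rfl⟩
  · exact ⟨((congrArg τ h).trans (hτ _)).symm, Or.inr rfl⟩

theorem mk_apply_mem_polygonEdges_iff {B : Type*} {σ τ : Equiv.Perm B} {P : B → Prop}
    (hσ : ∀ x, σ (σ x) = x) (hτ : ∀ x, τ (τ x) = x) (hPσ : ∀ x, P (σ x) ↔ P x)
    (hne : ∀ x, σ x ≠ τ x) (x : B) :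
    (∃ y, P y ∧ (s(x, σ x) = s(y, σ y) ∨ s(x, σ x) = s(y, τ y))) ↔ P x := by
  refine ⟨?_, fun h => ⟨x, h, Or.inl rfl⟩⟩
  rintro ⟨y, hy, h | h⟩
  · rcases (apply_eq_of_mk_apply_eq hσ h).2 with rfl | rfl
    · exact hy
    · exact (hPσ x).1 hy
  · exact absurd (apply_eq_of_mk_apply_eq hτ h).1 (hne x)

theorem not_mk_apply_mem_polygonEdges {B : Type*} {ρ σ τ : Equiv.Perm B} {P : B → Prop}
    (hσ : ∀ x, σ (σ x) = x) (hτ : ∀ x, τ (τ x) = x)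
    (hρσ : ∀ x, ρ x ≠ σ x) (hρτ : ∀ x, ρ x ≠ τ x) (x : B) :
    ¬ ∃ y, P y ∧ (s(x, ρ x) = s(y, σ y) ∨ s(x, ρ x) = s(y, τ y)) := by
  rintro ⟨y, -, h | h⟩
  · exact hρσ x (apply_eq_of_mk_apply_eq hσ h).1
  · exact hρτ x (apply_eq_of_mk_apply_eq hτ h).1


/-- in a properly 3-edge-coloured finite simple cubic graph (given
by fixed-point-free involutions `α`, `β`, `γ` with `α x`, `β x`, `γ x` pairwise
distinct), let `W` be the mod-2 sum of the edge sets of an arbitrary family of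
bicoloured (`ab`-, `bc`-, `ca`-) polygons.  Then every cycle of the graph all of
whose edges lie in `W` has even length. -/
theorem cycles_in_symmdiff_of_bicoloured_polygons_even
    {B : Type} [Fintype B] [DecidableEq B]
    (α β γ : Equiv.Perm B)
    (hα : ∀ x, α (α x) = x) (hα' : ∀ x, α x ≠ x)
    (hβ : ∀ x, β (β x) = x) (hβ' : ∀ x, β x ≠ x)
    (hγ : ∀ x, γ (γ x) = x) (hγ' : ∀ x, γ x ≠ x)
    (hdist : ∀ x, α x ≠ β x ∧ β x ≠ γ x ∧ α x ≠ γ x)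
    (G : SimpleGraph B)
    (hG : ∀ x y, G.Adj x y ↔ (y = α x ∨ y = β x ∨ y = γ x))
    -- the chosen family of bicoloured polygons, one subset per colour pair:
    (Sab : Set (MulAction.orbitRel.Quotient
        (Subgroup.closure {α, β} : Subgroup (Equiv.Perm B)) B))
    (Sbc : Set (MulAction.orbitRel.Quotient
        (Subgroup.closure {β, γ} : Subgroup (Equiv.Perm B)) B))
    (Sca : Set (MulAction.orbitRel.Quotient
        (Subgroup.closure {γ, α} : Subgroup (Equiv.Perm B)) B))
    (W : Set (Sym2 B))
    -- `W` is the mod-2 sum (symmetric difference) of the edge sets of the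
    -- chosen polygons (polygons of the same colour pair are edge-disjoint):
    (hW : W = symmDiff (symmDiff
      {e : Sym2 B | ∃ x : B,
        Quotient.mk (MulAction.orbitRel
          (Subgroup.closure {α, β} : Subgroup (Equiv.Perm B)) B) x ∈ Sab ∧
        (e = s(x, α x) ∨ e = s(x, β x))}
      {e : Sym2 B | ∃ x : B,
        Quotient.mk (MulAction.orbitRel
          (Subgroup.closure {β, γ} : Subgroup (Equiv.Perm B)) B) x ∈ Sbc ∧
        (e = s(x, β x) ∨ e = s(x, γ x))})
      {e : Sym2 B | ∃ x : B,
        Quotient.mk (MulAction.orbitRel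
          (Subgroup.closure {γ, α} : Subgroup (Equiv.Perm B)) B) x ∈ Sca ∧
        (e = s(x, γ x) ∨ e = s(x, α x))}) :
    ∀ (x : B) (p : G.Walk x x), p.IsCycle → (∀ e ∈ p.edges, e ∈ W) →
      Even p.length := by
  intro u p hp hpW
  have hab x : α x ≠ β x := (hdist x).1
  have hbc x : β x ≠ γ x := (hdist x).2.1
  have hac x : α x ≠ γ x := (hdist x).2.2
  obtain ⟨X, hX⟩ : ∃ X : B → Prop, ∀ x, X x ↔ Quotient.mk (MulAction.orbitRel
    (Subgroup.closure {α, β} : Subgroup (Equiv.Perm B)) B) x ∈ Sab := ⟨_, fun _ => Iff.rfl⟩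
  obtain ⟨Y, hY⟩ : ∃ Y : B → Prop, ∀ x, Y x ↔ Quotient.mk (MulAction.orbitRel
    (Subgroup.closure {β, γ} : Subgroup (Equiv.Perm B)) B) x ∈ Sbc := ⟨_, fun _ => Iff.rfl⟩
  obtain ⟨Z, hZ⟩ : ∃ Z : B → Prop, ∀ x, Z x ↔ Quotient.mk (MulAction.orbitRel
    (Subgroup.closure {γ, α} : Subgroup (Equiv.Perm B)) B) x ∈ Sca := ⟨_, fun _ => Iff.rfl⟩
  have hXα x : X (α x) ↔ X x := by
    rw [hX, hX, mk_orbitRel_apply_of_mem _ (Subgroup.subset_closure (by simp))]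
  have hXβ x : X (β x) ↔ X x := by
    rw [hX, hX, mk_orbitRel_apply_of_mem _ (Subgroup.subset_closure (by simp))]
  have hYβ x : Y (β x) ↔ Y x := by
    rw [hY, hY, mk_orbitRel_apply_of_mem _ (Subgroup.subset_closure (by simp))]
  have hYγ x : Y (γ x) ↔ Y x := by
    rw [hY, hY, mk_orbitRel_apply_of_mem _ (Subgroup.subset_closure (by simp))]
  have hZγ x : Z (γ x) ↔ Z x := by
    rw [hZ, hZ, mk_orbitRel_apply_of_mem _ (Subgroup.subset_closure (by simp))]
  have hZα x : Z (α x) ↔ Z x := by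
    rw [hZ, hZ, mk_orbitRel_apply_of_mem _ (Subgroup.subset_closure (by simp))]
  simp only [← hX, ← hY, ← hZ] at hW
  have hWα x : s(x, α x) ∈ W ↔ ¬ (X x ↔ Z x) := by
    have h1 := mk_apply_mem_polygonEdges_iff hα hβ hXα hab x
    have h2 := not_mk_apply_mem_polygonEdges (P := Y) hβ hγ hab hac x
    have h3 := mk_apply_mem_polygonEdges_iff hα hγ hZα hac x
    simp only [or_comm (a := s(x, α x) = s(_, α _)) (b := s(x, α x) = s(_, γ _))] at h3
    simp only [hW, Set.mem_symmDiff, Set.mem_ofPred_eq, h1, h2, h3]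
    tauto
  have hWβ x : s(x, β x) ∈ W ↔ ¬ (X x ↔ Y x) := by
    have h1 := mk_apply_mem_polygonEdges_iff hβ hα hXβ (fun x => (hab x).symm) x
    have h2 := mk_apply_mem_polygonEdges_iff hβ hγ hYβ hbc x
    have h3 := not_mk_apply_mem_polygonEdges (P := Z) hγ hα hbc (fun x => (hab x).symm) x
    simp only [or_comm (a := s(x, β x) = s(_, β _)) (b := s(x, β x) = s(_, α _))] at h1
    simp only [hW, Set.mem_symmDiff, Set.mem_ofPred_eq, h1, h2, h3]
    tauto
  have hWγ x : s(x, γ x) ∈ W ↔ ¬ (Y x ↔ Z x) := by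
    have h1 := not_mk_apply_mem_polygonEdges (P := X) hα hβ (fun x => (hac x).symm)
      (fun x => (hbc x).symm) x
    have h2 := mk_apply_mem_polygonEdges_iff hγ hβ hYγ (fun x => (hbc x).symm) x
    have h3 := mk_apply_mem_polygonEdges_iff hγ hα hZγ (fun x => (hac x).symm) x
    simp only [or_comm (a := s(x, γ x) = s(_, γ _)) (b := s(x, γ x) = s(_, β _))] at h2
    simp only [hW, Set.mem_symmDiff, Set.mem_ofPred_eq, h1, h2, h3]
    tauto
  -- Two-colour the edges of `W`: an edge lying on polygons of two types is marked according to
  -- the indicator of one of them, chosen cyclically.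
  obtain ⟨F, hF⟩ : ∃ F : Sym2 B → Prop, ∀ e, F e ↔ ∃ x, (e = s(x, α x) ∧ Z x) ∨
    (e = s(x, β x) ∧ X x) ∨ (e = s(x, γ x) ∧ Y x) := ⟨_, fun _ => Iff.rfl⟩
  have hFα x : F s(x, α x) ↔ Z x := by
    refine (hF _).trans ⟨?_, fun h => ⟨x, Or.inl ⟨rfl, h⟩⟩⟩
    rintro ⟨y, ⟨h, hy⟩ | ⟨h, hy⟩ | ⟨h, hy⟩⟩
    · rcases (apply_eq_of_mk_apply_eq hα h).2 with rfl | rfl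
      exacts [hy, (hZα x).1 hy]
    · exact absurd (apply_eq_of_mk_apply_eq hβ h).1 (hab x)
    · exact absurd (apply_eq_of_mk_apply_eq hγ h).1 (hac x)
  have hFβ x : F s(x, β x) ↔ X x := by
    refine (hF _).trans ⟨?_, fun h => ⟨x, Or.inr (Or.inl ⟨rfl, h⟩)⟩⟩
    rintro ⟨y, ⟨h, hy⟩ | ⟨h, hy⟩ | ⟨h, hy⟩⟩
    · exact absurd (apply_eq_of_mk_apply_eq hα h).1 (hab x).symm
    · rcases (apply_eq_of_mk_apply_eq hβ h).2 with rfl | rfl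
      exacts [hy, (hXβ x).1 hy]
    · exact absurd (apply_eq_of_mk_apply_eq hγ h).1 (hbc x)
  have hFγ x : F s(x, γ x) ↔ Y x := by
    refine (hF _).trans ⟨?_, fun h => ⟨x, Or.inr (Or.inr ⟨rfl, h⟩)⟩⟩
    rintro ⟨y, ⟨h, hy⟩ | ⟨h, hy⟩ | ⟨h, hy⟩⟩
    · exact absurd (apply_eq_of_mk_apply_eq hα h).1 (hac x).symm
    · exact absurd (apply_eq_of_mk_apply_eq hβ h).1 (hbc x).symm
    · rcases (apply_eq_of_mk_apply_eq hγ h).2 with rfl | rfl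
      exacts [hy, (hYγ x).1 hy]
  refine hp.even_length_of_alternating F fun x y z hxy hyz hxz => ?_
  rw [Sym2.eq_swap (a := x)] at hxy ⊢
  have hyx := (hG y x).1 (p.adj_of_mem_edges hxy)
  have hyz' := (hG y z).1 (p.adj_of_mem_edges hyz)
  have hw1 := hpW _ hxy
  have hw2 := hpW _ hyz
  rcases hyx with rfl | rfl | rfl <;> rcases hyz' with rfl | rfl | rfl <;>
    first
    | exact absurd rfl hxz
    | simp only [hWα, hWβ, hWγ] at hw1 hw2
      simp only [hFα, hFβ, hFγ]
      revert hw1 hw2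
      clear * -
      tauto
end

section
/- Let G be a finite simple graph. A set S of edges of G is a maximal coboundary (maximal, under inclusion, among all edge cuts δ(A) = {edges of G with exactly one end in A}, A ranging over vertex subsets) if and only if its complement E(G) \ S is a minimal transversal of odd circuits, i.e. a set T of edges, minimal under inclusion, such that the graph obtained from G by deleting the edges in T is bipartite (equivalently, such that T meets the edge set of every odd-length cycle of G). -/
/-- A coboundary (edge cut) of a simple graph: the set of edges with exactly
one end in `A`, for some vertex set `A`. -/
def IsCoboundary {V : Type} (G : SimpleGraph V) (S : Set (Sym2 V)) : Prop :=
  ∃ A : Set V, S = {e : Sym2 V | e ∈ G.edgeSet ∧ ∃ x y, e = s(x, y) ∧ x ∈ A ∧ y ∉ A}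

/-- A transversal of odd circuits: a set of edges meeting every odd cycle. -/
def IsOddCircuitTransversal {V : Type} (G : SimpleGraph V) (T : Set (Sym2 V)) : Prop :=
  T ⊆ G.edgeSet ∧
    ∀ (x : V) (p : G.Walk x x), p.IsCycle → Odd p.length → ∃ e ∈ p.edges, e ∈ T

namespace SimpleGraph

variable {V : Type*} {G : SimpleGraph V}

namespace Walk

/-- A path closed up by an edge `h` is a cycle as soon as its length is even. -/
lemma IsPath.isCycle_cons_of_even {u v : V} {q : G.Walk v u} (hq : q.IsPath) (h : G.Adj u v)
    (he : Even q.length) : (cons h q).IsCycle := by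
  refine (cons_isCycle_iff q h).2 ⟨hq, fun hmem ↦ ?_⟩
  rw [hq.length_eq_one_of_mem_edges (Sym2.eq_swap ▸ hmem)] at he
  exact Nat.not_even_one he

/-- In a graph without odd cycles, bypassing a walk preserves the parity of its length. -/
lemma even_length_bypass_iff [DecidableEq V]
    (hG : ∀ (x : V) (c : G.Walk x x), c.IsCycle → ¬ Odd c.length) {u v : V} (p : G.Walk u v) :
    Even p.bypass.length ↔ Even p.length := by
  induction p with
  | nil => simp [bypass]
  | @cons u w v h p ih =>
    rw [bypass, length_cons]
    split_ifs with hu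
    · have hpath : (p.bypass.takeUntil u hu).IsPath := p.bypass_isPath.takeUntil hu
      have hodd : ¬ Even (p.bypass.takeUntil u hu).length := fun he ↦
        hG u _ (hpath.isCycle_cons_of_even h he) (by rw [length_cons]; exact he.add_one)
      have hlen := congrArg Walk.length (p.bypass.take_spec hu)
      rw [length_append] at hlen
      rw [Nat.even_add_one, ← ih, ← hlen, Nat.even_add]
      tauto
    · rw [length_cons, Nat.even_add_one, Nat.even_add_one, ih]

end Walk

/-- A graph without odd cycles is bipartite. -/
lemma isBipartite_of_forall_isCycle_not_odd
    (hG : ∀ (x : V) (c : G.Walk x x), c.IsCycle → ¬ Odd c.length) : G.IsBipartite := by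
  classical
  refine two_colorable_iff_forall_loop_even.2 fun u w ↦ ?_
  rw [← w.even_length_bypass_iff hG, (Walk.isPath_iff_nil.1 w.bypass_isPath).length_eq_zero]
  exact Even.zero

/-- Along a walk each of whose edges crosses `A`, the parity records the change of side. -/
lemma Walk.even_length_iff_of_edges_cross {A : Set V} {u v : V} (p : G.Walk u v)
    (hp : ∀ e ∈ p.edges, ∃ x y, e = s(x, y) ∧ x ∈ A ∧ y ∉ A) :
    Even p.length ↔ (u ∈ A ↔ v ∈ A) := by
  induction p with
  | nil => simp
  | @cons u w v h p ih =>
    simp only [edges_cons, List.mem_cons, forall_eq_or_imp] at hp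
    obtain ⟨⟨x, y, hxy, hx, hy⟩, hp⟩ := hp
    rw [length_cons, Nat.even_add_one, ih hp]
    rcases Sym2.eq_iff.1 hxy with ⟨rfl, rfl⟩ | ⟨rfl, rfl⟩ <;> tauto

end SimpleGraph

section Coboundary

variable {V : Type} {G : SimpleGraph V} {S T : Set (Sym2 V)}

lemma IsCoboundary.subset_edgeSet (h : IsCoboundary G S) : S ⊆ G.edgeSet := by
  obtain ⟨A, rfl⟩ := h
  exact fun e he ↦ he.1

lemma IsCoboundary.isOddCircuitTransversal_diff (h : IsCoboundary G S) :
    IsOddCircuitTransversal G (G.edgeSet \ S) := by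
  refine ⟨Set.sdiff_subset, fun x p _ hodd ↦ ?_⟩
  by_contra! hp
  obtain ⟨A, rfl⟩ := h
  refine Nat.not_even_iff_odd.2 hodd ((p.even_length_iff_of_edges_cross (A := A) ?_).2 Iff.rfl)
  intro e he
  have heG := p.edges_subset_edgeSet he
  by_contra hcross
  exact hp e he ⟨heG, fun heS ↦ hcross heS.2⟩

lemma IsOddCircuitTransversal.exists_isCoboundary (h : IsOddCircuitTransversal G T) :
    ∃ S, IsCoboundary G S ∧ G.edgeSet \ T ⊆ S := by
  obtain ⟨c⟩ : (G.deleteEdges T).IsBipartite := by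
    refine SimpleGraph.isBipartite_of_forall_isCycle_not_odd fun x p hp hodd ↦ ?_
    have hle := G.deleteEdges_le T
    obtain ⟨e, he, heT⟩ := h.2 x (p.mapLe hle) (hp.mapLe hle) (by simpa using hodd)
    have hmem := p.edges_subset_edgeSet (by simpa using he)
    rw [SimpleGraph.edgeSet_deleteEdges] at hmem
    exact hmem.2 heT
  refine ⟨_, ⟨{v | c v = 0}, rfl⟩, fun e he ↦ ⟨he.1, ?_⟩⟩
  induction e with
  | h x y =>
    have hne : c x ≠ c y := c.valid (SimpleGraph.deleteEdges_adj.2 he)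
    by_cases hx : c x = 0
    · exact ⟨x, y, rfl, hx, fun hy ↦ hne (hx.trans hy.symm)⟩
    · exact ⟨y, x, Sym2.eq_swap, by simp only [Set.mem_ofPred_eq]; omega, hx⟩

end Coboundary

/-- a set `S` of edges of a finite simple graph `G` is a maximal
coboundary if and only if its complement `E(G) \ S` is a minimal transversal of
odd circuits. -/
theorem maximal_coboundary_iff_complement_minimal_odd_transversal
    {V : Type} [Fintype V] (G : SimpleGraph V) (S : Set (Sym2 V))
    (hS : S ⊆ G.edgeSet) :
    Maximal (IsCoboundary G) S ↔
      Minimal (IsOddCircuitTransversal G) (G.edgeSet \ S) := by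
  constructor
  · refine fun h ↦ ⟨h.prop.isOddCircuitTransversal_diff, fun T hT hTS e he ↦ ?_⟩
    obtain ⟨S', hS', hTS'⟩ := hT.exists_isCoboundary
    have hSS' : S ⊆ S' := fun f hf ↦ hTS' ⟨hS hf, fun hfT ↦ (hTS hfT).2 hf⟩
    by_contra heT
    exact he.2 (h.le_of_ge hS' hSS' (hTS' ⟨he.1, heT⟩))
  · intro h
    have key : ∀ S', IsCoboundary G S' → S ⊆ S' → S' ⊆ S := fun S' hS' hSS' e he ↦ by
      by_contra heS
      exact (h.le_of_le hS'.isOddCircuitTransversal_diff (Set.sdiff_subset_sdiff_right hSS')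
        ⟨hS'.subset_edgeSet he, heS⟩).2 he
    refine ⟨?_, key⟩
    obtain ⟨S', hS', hSS'⟩ := h.prop.exists_isCoboundary
    rw [Set.sdiff_sdiff_cancel_left hS] at hSS'
    rwa [hSS'.antisymm (key S' hS' hSS')]
end
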